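/- arXiv:1802.05232 — 8 statements merged into one kernel-verified Lean document; each statement's English description precedes it below -/
import Mathlib

section
/- Let n ≥ 1 and let Γ be a finite subgroup of O(n) satisfying the standing hypotheses (a), (b), (c). Then for every isotropy plane P of Γ, the collection of isotropy semiaxes of Γ that are contained in P is covered by at most two Γ-orbits of semiaxes; that is, there exist isotropy semiaxes L, L′ such that every isotropy semiaxis contained in P equals γ·L or γ·L′ for some γ ∈ Γ. -/
noncomputable section

/-- `ℝⁿ` as a Euclidean space. -/
abbrev Vn (n : ℕ) := EuclideanSpace ℝ (Fin n)

/-- The orthogonal group `O(n)`, realized as linear isometric self-equivalences of `ℝⁿ`. -/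
abbrev On (n : ℕ) := Vn n ≃ₗᵢ[ℝ] Vn n

/-- `Fix(S) = {x : σ x = x for all σ ∈ S}`. -/
def FixSet {n : ℕ} (S : Subgroup (On n)) : Set (Vn n) :=
  {x | ∀ σ ∈ S, σ x = x}

/-- An isotropy plane of `Γ`: a two-dimensional subspace of the form `Fix(Σ)`
for a subgroup `Σ ≤ Γ`. -/
def IsIsotropyPlane {n : ℕ} (Γ : Subgroup (On n)) (P : Submodule ℝ (Vn n)) : Prop :=
  Module.finrank ℝ P = 2 ∧ ∃ S : Subgroup (On n), S ≤ Γ ∧ (P : Set (Vn n)) = FixSet S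

/-- The ray (open semiaxis) spanned by `v`. -/
def ray {n : ℕ} (v : Vn n) : Set (Vn n) := {x | ∃ t : ℝ, 0 < t ∧ x = t • v}

/-- An isotropy semiaxis of `Γ`: a ray `{t v : t > 0}`, `v ≠ 0`, whose spanned line `ℝ v`
equals `Fix(Δ)` for some subgroup `Δ ≤ Γ`. -/
def IsIsotropySemiaxis {n : ℕ} (Γ : Subgroup (On n)) (L : Set (Vn n)) : Prop :=
  ∃ v : Vn n, v ≠ 0 ∧ L = ray v ∧ ∃ Δ : Subgroup (On n), Δ ≤ Γ ∧
    ((Submodule.span ℝ {v} : Submodule ℝ (Vn n)) : Set (Vn n)) = FixSet Δ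

/-- The isotropy subgroup `Δ_L = {γ ∈ Γ : γ x = x for all x ∈ L}` of a semiaxis `L`. -/
def semiaxisStab {n : ℕ} (Γ : Subgroup (On n)) (L : Set (Vn n)) : Subgroup (On n) where
  carrier := {γ | γ ∈ Γ ∧ ∀ x ∈ L, γ x = x}
  one_mem' := ⟨Γ.one_mem, fun x _ => rfl⟩
  mul_mem' := by
    rintro a b ⟨ha, ha'⟩ ⟨hb, hb'⟩
    refine ⟨Γ.mul_mem ha hb, fun x hx => ?_⟩
    show a (b x) = x
    rw [hb' x hx, ha' x hx]
  inv_mem' := by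
    rintro a ⟨ha, ha'⟩
    refine ⟨Γ.inv_mem ha, fun x hx => ?_⟩
    show a.symm x = x
    conv_lhs => rw [← ha' x hx]
    exact a.symm_apply_apply x

/-- A subspace `W` is invariant under a subgroup `Δ`. -/
def Invariant {n : ℕ} (Δ : Subgroup (On n)) (W : Submodule ℝ (Vn n)) : Prop :=
  ∀ δ ∈ Δ, ∀ x ∈ W, δ x ∈ W

/-- Two (`Δ`-invariant) subspaces `W₁`, `W₂` are isomorphic as real representations of `Δ`:
there is a linear equivalence intertwining the `Δ`-actions. -/
def RepIso {n : ℕ} (Δ : Subgroup (On n)) (W₁ W₂ : Submodule ℝ (Vn n)) : Prop :=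
  ∃ e : W₁ ≃ₗ[ℝ] W₂, ∀ δ ∈ Δ, ∀ x y : W₁, (y : Vn n) = δ (x : Vn n) →
    ((e y : Vn n) = δ ((e x : Vn n)))

/-- A semiaxis `L` is simple: `ℝⁿ` decomposes into `n` one-dimensional `Δ_L`-invariant
subspaces that are pairwise non-isomorphic as real representations of `Δ_L`. -/
def IsSimpleSemiaxis {n : ℕ} (Γ : Subgroup (On n)) (L : Set (Vn n)) : Prop :=
  ∃ ℓ : Fin n → Submodule ℝ (Vn n), DirectSum.IsInternal ℓ ∧
    (∀ i, Module.finrank ℝ (ℓ i) = 1) ∧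
    (∀ i, Invariant (semiaxisStab Γ L) (ℓ i)) ∧
    Pairwise fun i j => ¬ RepIso (semiaxisStab Γ L) (ℓ i) (ℓ j)

theorem aux_perp {n : ℕ} (P : Submodule ℝ (Vn n)) (hP : Module.finrank ℝ P = 2)
    (v : Vn n) (hv : v ∈ P) (hv1 : inner ℝ v v = (1 : ℝ)) :
    ∃ w ∈ P, inner ℝ w w = (1 : ℝ) ∧ inner ℝ v w = (0 : ℝ) ∧
      ∀ x ∈ P, x = (inner ℝ v x : ℝ) • v + (inner ℝ w x : ℝ) • w := by
  let b := (stdOrthonormalBasis ℝ P).reindex (finCongr hP)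
  obtain ⟨e, he⟩ : ∃ e : Vn n, e = (b 0 : Vn n) := ⟨_, rfl⟩
  obtain ⟨f, hf⟩ : ∃ f : Vn n, f = (b 1 : Vn n) := ⟨_, rfl⟩
  have hee : inner ℝ e e = (1 : ℝ) := by
    rw [he]
    exact (b.inner_eq_ite 0 0).trans (if_pos rfl)
  have hff : inner ℝ f f = (1 : ℝ) := by
    rw [hf]
    exact (b.inner_eq_ite 1 1).trans (if_pos rfl)
  have hef : inner ℝ e f = (0 : ℝ) := by
    rw [he, hf]
    exact (b.inner_eq_ite 0 1).trans (if_neg (by decide))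
  have hfe : inner ℝ f e = (0 : ℝ) := by rw [real_inner_comm]; exact hef
  have heP : e ∈ P := by rw [he]; exact (b 0).2
  have hfP : f ∈ P := by rw [hf]; exact (b 1).2
  have hx : ∀ x ∈ P, ∃ s t : ℝ, x = s • e + t • f := by
    intro x hx
    have := b.sum_repr ⟨x, hx⟩
    rw [Fin.sum_univ_two] at this
    refine ⟨b.repr ⟨x, hx⟩ 0, b.repr ⟨x, hx⟩ 1, ?_⟩
    have h2 := congrArg (Subtype.val) this
    rw [he, hf]
    simpa using h2.symm
  obtain ⟨p, q, rfl⟩ := hx v hv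
  have hpq : p * p + q * q = 1 := by
    simp only [inner_add_left, inner_add_right, real_inner_smul_left, real_inner_smul_right,
      hee, hff, hef, hfe] at hv1
    linarith
  refine ⟨(-q) • e + p • f, P.add_mem (P.smul_mem _ heP) (P.smul_mem _ hfP), ?_, ?_, ?_⟩
  · simp only [inner_add_left, inner_add_right, real_inner_smul_left, real_inner_smul_right,
      hee, hff, hef, hfe]
    linarith
  · simp only [inner_add_left, inner_add_right, real_inner_smul_left, real_inner_smul_right,
      hee, hff, hef, hfe]
    ring
  · intro x hxP
    obtain ⟨s, t, rfl⟩ := hx x hxP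
    simp only [inner_add_left, inner_add_right, real_inner_smul_left, real_inner_smul_right,
      hee, hff, hef, hfe]
    have h1 : (p * (s * 1) + q * (s * 0) + (p * (t * 0) + q * (t * 1))) * p
        + (-q * (s * 1) + p * (s * 0) + (-q * (t * 0) + p * (t * 1))) * (-q) = s := by
      linear_combination s * hpq
    have h2 : (p * (s * 1) + q * (s * 0) + (p * (t * 0) + q * (t * 1))) * q
        + (-q * (s * 1) + p * (s * 0) + (-q * (t * 0) + p * (t * 1))) * p = t := by
      linear_combination t * hpq
    conv_lhs => rw [← h1, ← h2]
    module

theorem aux_real (c d s t : ℝ) (hc : c * c + t * t = 1) (hd : d * d + s * s = 1)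
    (hcd : d ≤ c) (hc1 : c < 1)
    (h1 : c * d + t * s ≤ d) (h2 : 2 * c * d - (c * d + t * s) ≤ d) : False := by
  have hd0 : 0 ≤ d := by
    by_contra h
    nlinarith
  have h3 : 0 ≤ (d - (c * d + t * s)) * (d - (2 * c * d - (c * d + t * s))) :=
    mul_nonneg (by linarith) (by linarith)
  have h4 : (t * s) * (t * s) = (1 - c * c) * (1 - d * d) := by
    have : t * t = 1 - c * c := by linarith
    have h' : s * s = 1 - d * d := by linarith
    calc (t * s) * (t * s) = (t * t) * (s * s) := by ring
      _ = _ := by rw [this, h']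
  have h5 : 0 ≤ (1 - c) * (2 * d * d - (1 + c)) := by nlinarith
  have h6 : 0 ≤ 2 * d * d - (1 + c) := nonneg_of_mul_nonneg_right h5 (by linarith)
  nlinarith

/-- unit vectors of `P` whose reflection is realized in `Γ`. -/
def Refl {n : ℕ} (Γ : Subgroup (On n)) (P : Submodule ℝ (Vn n)) : Set (Vn n) :=
  {v | v ∈ P ∧ inner ℝ v v = (1 : ℝ) ∧
    ∃ δ ∈ Γ, ∀ x ∈ P, δ x = (2 * inner ℝ v x : ℝ) • v - x}

theorem unit_eq_of_inner {n : ℕ} (a b : Vn n) (ha : inner ℝ a a = (1 : ℝ))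
    (hb : inner ℝ b b = (1 : ℝ)) (h : (1 : ℝ) ≤ inner ℝ a b) : a = b := by
  have : inner ℝ (a - b) (a - b) ≤ (0 : ℝ) := by
    rw [inner_sub_left, inner_sub_right, inner_sub_right, ha, hb, real_inner_comm a b]
    linarith
  have h2 : a - b = 0 := inner_self_eq_zero (𝕜 := ℝ).mp (le_antisymm this real_inner_self_nonneg)
  exact sub_eq_zero.mp h2

theorem refl_neg {n : ℕ} (Γ : Subgroup (On n)) (P : Submodule ℝ (Vn n)) (v : Vn n)
    (hv : v ∈ Refl Γ P) : -v ∈ Refl Γ P := by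
  obtain ⟨h1, h2, δ, h3, h4⟩ := hv
  refine ⟨P.neg_mem h1, by simpa using h2, δ, h3, fun x hx => ?_⟩
  rw [h4 x hx, inner_neg_left]
  module

theorem refl_finite {n : ℕ} (Γ : Subgroup (On n)) (hfin : (Γ : Set (On n)).Finite)
    (P : Submodule ℝ (Vn n)) : (Refl Γ P).Finite := by
  have : Refl Γ P ⊆ ⋃ δ ∈ (Γ : Set (On n)), {v | v ∈ P ∧ inner ℝ v v = (1 : ℝ) ∧
      ∀ x ∈ P, δ x = (2 * inner ℝ v x : ℝ) • v - x} := by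
    rintro v ⟨h1, h2, δ, h3, h4⟩
    simp only [Set.mem_iUnion]
    exact ⟨δ, h3, h1, h2, h4⟩
  refine (hfin.biUnion fun δ _ => ?_).subset this
  rcases Set.eq_empty_or_nonempty {v | v ∈ P ∧ inner ℝ v v = (1 : ℝ) ∧
      ∀ x ∈ P, δ x = (2 * inner ℝ v x : ℝ) • v - x} with h | ⟨v, hv1, hv2, hv3⟩
  · rw [h]; exact Set.finite_empty
  · refine (Set.toFinite {v, -v}).subset ?_
    rintro w ⟨hw1, hw2, hw3⟩
    have e := (hv3 w hw1).symm.trans (hw3 w hw1)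
    rw [hw2] at e
    have e2 : w = (inner ℝ v w : ℝ) • v := by
      have : (2 : ℝ) • w = (2 : ℝ) • ((inner ℝ v w : ℝ) • v) := by
        have e3 := congrArg (· + w) e
        simp only [sub_add_cancel, mul_one] at e3
        rw [← e3, smul_smul]
      exact smul_right_injective _ (two_ne_zero) this
    have e4 : (inner ℝ v w : ℝ) * inner ℝ v w = 1 := by
      have := congrArg (fun y => (inner ℝ w y : ℝ)) e2
      simp only [real_inner_smul_right, hw2] at this
      rw [real_inner_comm v w] at this
      linarith
    rcases mul_self_eq_one_iff.mp e4 with h | h <;> rw [h] at e2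
    · left; simpa using e2
    · right; simpa using e2

theorem refl_refl {n : ℕ} (Γ : Subgroup (On n)) (P : Submodule ℝ (Vn n)) (v w : Vn n)
    (δ : On n) (hδ : δ ∈ Γ) (hv : v ∈ P) (hv1 : inner ℝ v v = (1 : ℝ))
    (hδv : ∀ x ∈ P, δ x = (2 * inner ℝ v x : ℝ) • v - x)
    (hw : w ∈ Refl Γ P) : δ w ∈ Refl Γ P := by
  obtain ⟨h1, h2, ε, h3, h4⟩ := hw
  have hmap : ∀ x ∈ P, δ x ∈ P := fun x hx => by
    rw [hδv x hx]; exact P.sub_mem (P.smul_mem _ hv) hx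
  have hinv : ∀ x ∈ P, δ (δ x) = x := fun x hx => by
    rw [hδv _ (hmap x hx), hδv x hx, inner_sub_right, real_inner_smul_right, hv1]
    module
  refine ⟨hmap w h1, by simpa using h2, δ * ε * δ, Γ.mul_mem (Γ.mul_mem hδ h3) hδ, ?_⟩
  intro x hx
  change δ (ε (δ x)) = _
  rw [h4 _ (hmap x hx), map_sub, map_smul, hinv x hx]
  have : (inner ℝ w (δ x) : ℝ) = inner ℝ (δ w) x := by
    conv_rhs => rw [← hinv x hx]
    rw [δ.inner_map_map]
  rw [this]

theorem ray_smul {n : ℕ} (v : Vn n) (c : ℝ) (hc : 0 < c) : ray (c • v) = ray v := by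
  ext x
  constructor
  · rintro ⟨t, ht, rfl⟩
    exact ⟨t * c, mul_pos ht hc, by rw [smul_smul]⟩
  · rintro ⟨t, ht, rfl⟩
    exact ⟨t / c, div_pos ht hc, by rw [smul_smul, div_mul_cancel₀ _ hc.ne']⟩

theorem image_ray {n : ℕ} (γ : On n) (v : Vn n) : ⇑γ '' ray v = ray (γ v) := by
  ext x
  constructor
  · rintro ⟨_, ⟨t, ht, rfl⟩, rfl⟩
    exact ⟨t, ht, by rw [map_smul]⟩
  · rintro ⟨t, ht, rfl⟩
    exact ⟨t • v, ⟨t, ht, rfl⟩, by rw [map_smul]⟩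

theorem mem_ray {n : ℕ} (v : Vn n) : v ∈ ray v := ⟨1, one_pos, by simp⟩

theorem refl_semiaxis {n : ℕ} (Γ : Subgroup (On n)) (P : Submodule ℝ (Vn n))
    (hP : IsIsotropyPlane Γ P) (v : Vn n) (hv : v ∈ Refl Γ P) :
    IsIsotropySemiaxis Γ (ray v) := by
  obtain ⟨h1, h2, δ, h3, h4⟩ := hv
  obtain ⟨-, S, hS, hPS⟩ := hP
  refine ⟨v, ?_, rfl, semiaxisStab Γ (ray v), fun γ hγ => hγ.1, ?_⟩
  · rintro rfl; simp at h2
  ext x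
  constructor
  · intro hx γ hγ
    obtain ⟨c, rfl⟩ := Submodule.mem_span_singleton.mp hx
    rw [map_smul, hγ.2 v (mem_ray v)]
  · intro hx
    have hray : ∀ y ∈ ray v, y ∈ P := by
      rintro _ ⟨t, -, rfl⟩; exact P.smul_mem _ h1
    have hxP : x ∈ P := by
      rw [← SetLike.mem_coe, hPS]
      intro σ hσ
      refine hx σ ⟨hS hσ, fun y hy => ?_⟩
      have : y ∈ FixSet S := hPS ▸ hray y hy
      exact this σ hσ
    have hδx : δ x = x := by
      refine hx δ ⟨h3, ?_⟩
      rintro _ ⟨t, -, rfl⟩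
      rw [map_smul, h4 v h1, h2]
      module
    rw [h4 x hxP] at hδx
    refine Submodule.mem_span_singleton.mpr ⟨inner ℝ v x, ?_⟩
    have : (2 : ℝ) • ((inner ℝ v x : ℝ) • v) = (2 : ℝ) • x := by
      rw [sub_eq_iff_eq_add] at hδx
      rw [smul_smul, hδx, two_smul]
    exact smul_right_injective _ (two_ne_zero) this

theorem stab_comm {n : ℕ} (Γ : Subgroup (On n)) (L : Set (Vn n))
    (h : IsSimpleSemiaxis Γ L) (a b : On n) (ha : a ∈ semiaxisStab Γ L)
    (hb : b ∈ semiaxisStab Γ L) (x : Vn n) : a (b x) = b (a x) := by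
  obtain ⟨ℓ, h1, h2, h3, -⟩ := h
  have htop := h1.submodule_iSup_eq_top
  have hx : x ∈ ⨆ i, ℓ i := by rw [htop]; trivial
  induction hx using Submodule.iSup_induction' with
  | mem i x hx =>
    obtain ⟨c, hc⟩ : ∃ c : ℝ, ∀ y ∈ ℓ i, a y = c • y := by
      obtain ⟨e, he0, he⟩ := finrank_eq_one_iff'.mp (h2 i)
      obtain ⟨c, hc⟩ := he ⟨a e, h3 i a ha e e.2⟩
      refine ⟨c, fun y hy => ?_⟩
      obtain ⟨r, hr⟩ := he ⟨y, hy⟩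
      have hr' : r • (e : Vn n) = y := congrArg Subtype.val hr
      have hc' : c • (e : Vn n) = a e := congrArg Subtype.val hc
      rw [← hr', map_smul, ← hc', smul_comm]
    rw [hc _ (h3 i b hb x hx), hc x hx, map_smul]
  | zero => simp
  | add x y _ _ hx hy => simp only [map_add, hx, hy]

theorem semiaxis_refl {n : ℕ} (Γ : Subgroup (On n)) (P : Submodule ℝ (Vn n))
    (hP : IsIsotropyPlane Γ P) (L : Set (Vn n)) (hL : IsIsotropySemiaxis Γ L)
    (hs : IsSimpleSemiaxis Γ L) (hLP : L ⊆ (P : Set (Vn n))) :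
    ∃ v ∈ Refl Γ P, L = ray v := by
  obtain ⟨hP2, S, hS, hPS⟩ := hP
  obtain ⟨v₀, hv₀, hLv₀, Δ, hΔ, hΔs⟩ := hL
  obtain ⟨v, hv⟩ : ∃ v : Vn n, v = (‖v₀‖⁻¹ : ℝ) • v₀ := ⟨_, rfl⟩
  have hpos : 0 < ‖v₀‖ := norm_pos_iff.mpr hv₀
  have hLv : L = ray v := by rw [hLv₀, hv, ray_smul _ _ (inv_pos.mpr hpos)]
  have hv1 : inner ℝ v v = (1 : ℝ) := by
    rw [hv, real_inner_smul_left, real_inner_smul_right, real_inner_self_eq_norm_sq]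
    field_simp
  have hvL : v ∈ L := hLv ▸ mem_ray v
  have hvP : v ∈ P := hLP hvL
  refine ⟨v, ⟨hvP, hv1, ?_⟩, hLv⟩
  obtain ⟨w, hwP, hw1, hvw, hdec⟩ := aux_perp P hP2 v hvP hv1
  have hSD : ∀ σ ∈ S, σ ∈ semiaxisStab Γ L := fun σ hσ => ⟨hS hσ, fun y hy => by
    have : y ∈ FixSet S := hPS ▸ hLP hy
    exact this σ hσ⟩
  have hΔD : ∀ σ ∈ Δ, σ ∈ semiaxisStab Γ L := fun σ hσ => ⟨hΔ hσ, fun y hy => by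
    rw [hLv₀] at hy
    obtain ⟨t, -, rfl⟩ := hy
    have : t • v₀ ∈ FixSet Δ := hΔs ▸ Submodule.smul_mem _ _ (Submodule.mem_span_singleton_self v₀)
    exact this σ hσ⟩
  have key : ∀ δ ∈ semiaxisStab Γ L, δ w = w ∨ δ w = -w := by
    intro δ hδ
    have hδwP : δ w ∈ P := by
      rw [← SetLike.mem_coe, hPS]
      intro σ hσ
      rw [stab_comm Γ L hs σ δ (hSD σ hσ) hδ]
      have : w ∈ FixSet S := hPS ▸ hwP
      rw [this σ hσ]
    have h0 : (inner ℝ v (δ w) : ℝ) = 0 := by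
      conv_lhs => rw [← hδ.2 v hvL]
      rw [δ.inner_map_map, hvw]
    have e := hdec _ hδwP
    rw [h0, zero_smul, zero_add] at e
    have e2 : (inner ℝ w (δ w) : ℝ) * inner ℝ w (δ w) = 1 := by
      have h1 : (inner ℝ (δ w) (δ w) : ℝ) = 1 := by rw [δ.inner_map_map, hw1]
      rw [e, real_inner_smul_left, real_inner_smul_right, hw1] at h1
      linarith
    rcases mul_self_eq_one_iff.mp e2 with h | h <;> rw [h] at e
    · left; simpa using e
    · right; simpa using e
  obtain ⟨δ, hδ, hδw⟩ : ∃ δ ∈ semiaxisStab Γ L, δ w = -w := by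
    by_contra! hno
    have hw : w ∈ FixSet Δ := fun σ hσ =>
      (key σ (hΔD σ hσ)).resolve_right (hno σ (hΔD σ hσ))
    rw [← hΔs] at hw
    obtain ⟨c, rfl⟩ := Submodule.mem_span_singleton.mp hw
    rw [hv] at hvw
    simp only [real_inner_smul_left, real_inner_smul_right, real_inner_self_eq_norm_sq] at hvw hw1
    have : c = 0 := by
      have h3 := hpos.ne'
      by_contra hc
      simp [hc, h3] at hvw
    rw [this] at hw1
    simp at hw1
  refine ⟨δ, hδ.1, fun x hx => ?_⟩
  have e := hdec x hx
  have : δ x = (inner ℝ v x : ℝ) • v - (inner ℝ w x : ℝ) • w := by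
    conv_lhs => rw [e]
    rw [map_add, map_smul, map_smul, hδ.2 v hvL, hδw]
    module
  rw [this]
  have e' : (inner ℝ w x : ℝ) • w = x - (inner ℝ v x : ℝ) • v := eq_sub_of_add_eq' e.symm
  rw [e']
  module

/-- One step of the descent. -/
theorem step {n : ℕ} (Γ : Subgroup (On n)) (P : Submodule ℝ (Vn n))
    (hP : Module.finrank ℝ P = 2) (u u' : Vn n) (huu : u ≠ u')
    (hmax : ∀ x ∈ Refl Γ P, ∀ y ∈ Refl Γ P, x ≠ y → (inner ℝ x y : ℝ) ≤ inner ℝ u u')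
    (w : Vn n) (hw : w ∈ Refl Γ P) (γ : On n) (hγ : γ ∈ Γ)
    (h1 : γ u ∈ Refl Γ P) (h2 : γ u' ∈ Refl Γ P) (hne : γ u ≠ w) :
    ∃ ε ∈ Γ, ε u ∈ Refl Γ P ∧ ε u' ∈ Refl Γ P ∧
      (inner ℝ w (γ u) : ℝ) < inner ℝ w (ε u') := by
  by_contra! hcon
  obtain ⟨haP, ha1, δ, hδ, hδa⟩ := id h1
  have hb := hcon γ hγ h1 h2
  have hb' := hcon (δ * γ) (Γ.mul_mem hδ hγ)
    (refl_refl Γ P (γ u) (γ u) δ hδ haP ha1 hδa h1)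
    (refl_refl Γ P (γ u) (γ u') δ hδ haP ha1 hδa h2)
  change (inner ℝ w (δ (γ u')) : ℝ) ≤ _ at hb'
  rw [hδa _ h2.1, inner_sub_right, real_inner_smul_right] at hb'
  obtain ⟨m, hmP, hm1, ham, hdec⟩ := aux_perp P hP (γ u) haP ha1
  have hc := hmax _ h1 _ hw hne
  rw [← γ.inner_map_map u u'] at hc
  have hlt : (inner ℝ (γ u) (γ u') : ℝ) < 1 := by
    by_contra! h
    exact huu (γ.injective (unit_eq_of_inner _ _ ha1 h2.2.1 h))
  have hin : ∀ x ∈ P, ∀ y : Vn n, (inner ℝ x y : ℝ) =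
      inner ℝ (γ u) x * inner ℝ (γ u) y + inner ℝ m x * inner ℝ m y := by
    intro x hx y
    conv_lhs => rw [hdec x hx]
    rw [inner_add_left, real_inner_smul_left, real_inner_smul_left]
  have e1 := hin _ h2.1 (γ u')
  have e2 := hin _ hw.1 w
  have e3 := hin _ hw.1 (γ u')
  rw [h2.2.1] at e1
  rw [hw.2.1] at e2
  rw [real_inner_comm (γ u) w] at hb hb'
  rw [e3] at hb hb'
  refine aux_real (inner ℝ (γ u) (γ u')) (inner ℝ (γ u) w) (inner ℝ m w) (inner ℝ m (γ u'))
    e1.symm e2.symm hc hlt ?_ ?_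
  · linarith
  · linarith

/-- Under the standing hypotheses (a), (b), (c), every isotropy plane `P` of a
finite subgroup `Γ ≤ O(n)` contains isotropy semiaxes from at most two `Γ`-orbits: there are
isotropy semiaxes `L`, `L'` such that every isotropy semiaxis contained in `P` is `γ • L`
or `γ • L'` for some `γ ∈ Γ`. -/
theorem statement0 {n : ℕ} (hn : 1 ≤ n) (Γ : Subgroup (On n))
    (hfin : (Γ : Set (On n)).Finite)
    (ha : ∀ L : Set (Vn n), IsIsotropySemiaxis Γ L → IsSimpleSemiaxis Γ L)
    (hb : ∃ L : Set (Vn n), IsIsotropySemiaxis Γ L)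
    (hc : ∀ L : Set (Vn n), IsIsotropySemiaxis Γ L →
      ∃ P P' : Submodule ℝ (Vn n), IsIsotropyPlane Γ P ∧ IsIsotropyPlane Γ P' ∧ P ≠ P' ∧
        L ⊆ (P : Set (Vn n)) ∧ L ⊆ (P' : Set (Vn n)))
    (P : Submodule ℝ (Vn n)) (hP : IsIsotropyPlane Γ P) :
    ∃ L L' : Set (Vn n), IsIsotropySemiaxis Γ L ∧ IsIsotropySemiaxis Γ L' ∧
      ∀ L'' : Set (Vn n), IsIsotropySemiaxis Γ L'' → L'' ⊆ (P : Set (Vn n)) →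
        (∃ γ ∈ Γ, ⇑γ '' L = L'') ∨ (∃ γ ∈ Γ, ⇑γ '' L' = L'') := by
  rcases Set.eq_empty_or_nonempty (Refl Γ P) with hemp | ⟨v, hv⟩
  · obtain ⟨L, hL⟩ := hb
    refine ⟨L, L, hL, hL, fun L'' hL'' hsub => ?_⟩
    obtain ⟨v, hv, -⟩ := semiaxis_refl Γ P hP L'' hL'' (ha _ hL'') hsub
    rw [hemp] at hv
    exact hv.elim
  have hRfin := refl_finite Γ hfin P
  have hvne : v ≠ -v := by
    intro h
    have h1 := hv.2.1
    have h2 : (inner ℝ v v : ℝ) = inner ℝ v (-v) := congrArg (fun y => (inner ℝ v y : ℝ)) h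
    rw [inner_neg_right] at h2
    linarith
  obtain ⟨⟨u, u'⟩, ⟨hu, hu', huu⟩, hmax⟩ := Set.exists_max_image
    {p : Vn n × Vn n | p.1 ∈ Refl Γ P ∧ p.2 ∈ Refl Γ P ∧ p.1 ≠ p.2}
    (fun p => (inner ℝ p.1 p.2 : ℝ))
    ((hRfin.prod hRfin).subset fun p hp => ⟨hp.1, hp.2.1⟩)
    ⟨(v, -v), hv, refl_neg Γ P v hv, hvne⟩
  simp only at hu hu' huu
  have hmax1 : ∀ x ∈ Refl Γ P, ∀ y ∈ Refl Γ P, x ≠ y → (inner ℝ x y : ℝ) ≤ inner ℝ u u' :=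
    fun x hx y hy hxy => hmax (x, y) ⟨hx, hy, hxy⟩
  have hmax2 : ∀ x ∈ Refl Γ P, ∀ y ∈ Refl Γ P, x ≠ y → (inner ℝ x y : ℝ) ≤ inner ℝ u' u :=
    fun x hx y hy hxy => by rw [real_inner_comm u u']; exact hmax1 x hx y hy hxy
  refine ⟨ray u, ray u', refl_semiaxis Γ P hP u hu, refl_semiaxis Γ P hP u' hu', ?_⟩
  intro L'' hL'' hsub
  obtain ⟨w, hw, rfl⟩ := semiaxis_refl Γ P hP L'' hL'' (ha _ hL'') hsub
  obtain ⟨a, ⟨γ, hγ, h1, h2, hor⟩, hamax⟩ := Set.exists_max_image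
    {x : Vn n | ∃ γ ∈ Γ, γ u ∈ Refl Γ P ∧ γ u' ∈ Refl Γ P ∧ (x = γ u ∨ x = γ u')}
    (fun x => (inner ℝ w x : ℝ))
    (hRfin.subset fun x hx => by
      obtain ⟨γ, -, h1, h2, rfl | rfl⟩ := hx <;> assumption)
    ⟨u, 1, Γ.one_mem, hu, hu', Or.inl rfl⟩
  rcases hor with rfl | rfl
  · left
    refine ⟨γ, hγ, ?_⟩
    rw [image_ray]
    by_contra hne
    have hne' : γ u ≠ w := fun h => hne (by rw [h])
    obtain ⟨ε, hε, h3, h4, h5⟩ := step Γ P hP.1 u u' huu hmax1 w hw γ hγ h1 h2 hne'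
    exact absurd (hamax (ε u') ⟨ε, hε, h3, h4, Or.inr rfl⟩) (not_le.mpr h5)
  · right
    refine ⟨γ, hγ, ?_⟩
    rw [image_ray]
    by_contra hne
    have hne' : γ u' ≠ w := fun h => hne (by rw [h])
    obtain ⟨ε, hε, h3, h4, h5⟩ := step Γ P hP.1 u' u huu.symm hmax2 w hw γ hγ h2 h1 hne'
    exact absurd (hamax (ε u) ⟨ε, hε, h4, h3, Or.inl rfl⟩) (not_le.mpr h5)

end
end

section
/- Let A ≠ 0, α > 0, β > −1 and h < 1 be real numbers with α < h + β. Then for every (x₁,x₂) ∈ ℝ² with x₁ ≠ 0 and |x₂| < |x₁|^h, the point (y₁,y₂) := (A·|x₁|^α, x₂·|x₁|^β) satisfies |y₂| < |A|^{−(h+β)/α} · |y₁|^{(h+β)/α}, and the exponent (h+β)/α is strictly greater than 1. -/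
/-- For `A ≠ 0`, `α > 0`, `β > -1`, `h < 1` with `α < h + β`: whenever
`x₁ ≠ 0` and `|x₂| < |x₁|^h`, the point `(y₁,y₂) = (A|x₁|^α, x₂|x₁|^β)` satisfies
`|y₂| < |A|^{-(h+β)/α} |y₁|^{(h+β)/α}`, and the exponent `(h+β)/α` is greater than `1`. -/
theorem statement7 (A α β h : ℝ) (hA : A ≠ 0) (hα : 0 < α) (hβ : -1 < β)
    (hh : h < 1) (hcomp : α < h + β)
    (x₁ x₂ : ℝ) (hx₁ : x₁ ≠ 0) (hx₂ : |x₂| < |x₁| ^ h) :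
    |x₂ * |x₁| ^ β| < |A| ^ (-((h + β) / α)) * |A * |x₁| ^ α| ^ ((h + β) / α) ∧
    1 < (h + β) / α := by
  have ha : 0 < |A| := abs_pos.mpr hA
  have hx : 0 < |x₁| := abs_pos.mpr hx₁
  refine ⟨?_, (one_lt_div hα).mpr hcomp⟩
  have hb : 0 < |x₁| ^ β := Real.rpow_pos_of_pos hx β
  have hc : 0 < |x₁| ^ α := Real.rpow_pos_of_pos hx α
  have e : |A| ^ (-((h + β) / α)) * |A * |x₁| ^ α| ^ ((h + β) / α) = |x₁| ^ h * |x₁| ^ β := by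
    rw [abs_mul, abs_of_pos hc, Real.mul_rpow ha.le hc.le, ← mul_assoc, ← Real.rpow_add ha,
      neg_add_cancel, Real.rpow_zero, one_mul, ← Real.rpow_mul hx.le,
      mul_div_cancel₀ _ hα.ne', Real.rpow_add hx]
  rw [e, abs_mul, abs_of_pos hb]
  exact mul_lt_mul_of_pos_right hx₂ hb
end

section
/- (a) For real numbers h and t with 0 < h < 1 and 0 < t < 1, the set V := {(x₁,x₂) ∈ ℝ² : |x₂| < |x₁|^h and |x₂| < |x₁|^t} is a thick cusp. (b) For real numbers h and t with h > 1 and 0 < t < 1, the set V := {(x₁,x₂) ∈ ℝ² : |x₁|^h < |x₂| and |x₂| < |x₁|^t} is a thick cusp. -/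
open MeasureTheory

noncomputable section

/-- The cusp-shaped region `V(a₁,a₂,α) = {(x₁,x₂) : |a₁x₁ + a₂x₂| < max(|x₁|,|x₂|)^α}`. -/
def Vset (a₁ a₂ α : ℝ) : Set (ℝ × ℝ) :=
  {p | |a₁ * p.1 + a₂ * p.2| < (max |p.1| |p.2|) ^ α}

/-- `U ⊆ ℝ²` is a thin cusp: it has positive Lebesgue measure in every ball around the
origin, and near the origin it is contained (apart from the origin itself) in some
`V(a₁,a₂,α)` with `α > 1`. -/
def ThinCusp (U : Set (ℝ × ℝ)) : Prop :=
  (∀ δ : ℝ, 0 < δ → 0 < volume (Metric.ball (0 : ℝ × ℝ) δ ∩ U)) ∧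
  ∃ a₁ a₂ α δ : ℝ, 1 < α ∧ 0 < δ ∧
    (U ∩ Metric.ball (0 : ℝ × ℝ) δ) \ {(0, 0)} ⊆ Vset a₁ a₂ α

/-- `U ⊆ ℝ²` is a thick cusp: its complement is a union of finitely many thin cusps. -/
def ThickCusp (U : Set (ℝ × ℝ)) : Prop :=
  ∃ (m : ℕ) (T : Fin m → Set (ℝ × ℝ)), (∀ i, ThinCusp (T i)) ∧ Uᶜ = ⋃ i, T i

lemma thin_of_open {U W : Set (ℝ × ℝ)} (hW : IsOpen W) (hWU : W ⊆ U)
    (hne : ∀ δ : ℝ, 0 < δ → ∃ p, p ∈ Metric.ball (0 : ℝ × ℝ) δ ∩ W) :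
    ∀ δ : ℝ, 0 < δ → 0 < volume (Metric.ball (0 : ℝ × ℝ) δ ∩ U) := by
  intro δ hδ
  have h1 : 0 < volume (Metric.ball (0 : ℝ × ℝ) δ ∩ W) :=
    (Metric.isOpen_ball.inter hW).measure_pos _ (hne δ hδ)
  exact h1.trans_le (measure_mono (Set.inter_subset_inter_right _ hWU))

lemma thin_T (s : ℝ) (h0 : 0 < s) (h1 : s < 1) :
    ThinCusp {p : ℝ × ℝ | |p.1| ^ s ≤ |p.2|} := by
  refine ⟨thin_of_open (W := {p : ℝ × ℝ | |p.1| ^ s < |p.2|}) ?_ ?_ ?_, ?_⟩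
  · refine isOpen_lt ?_ (by fun_prop)
    exact (continuous_fst.abs).rpow_const (fun _ => Or.inr h0.le)
  · intro p hp
    simp only [Set.mem_ofPred_eq] at hp ⊢
    exact hp.le
  · intro δ hδ
    refine ⟨(0, δ / 2), ?_, ?_⟩
    · rw [mem_ball_zero_iff, Prod.norm_def]
      simp only [norm_zero, Real.norm_eq_abs, abs_of_pos (half_pos hδ)]
      exact max_lt hδ (half_lt_self hδ)
    · simp only [Set.mem_ofPred_eq, abs_zero, Real.zero_rpow h0.ne']
      exact abs_pos.2 (half_pos hδ).ne'
  · have hs : 1 < s⁻¹ := (one_lt_inv₀ h0).2 h1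
    obtain ⟨α, ha1, ha2⟩ := exists_between hs
    refine ⟨1, 0, α, 1, ha1, one_pos, ?_⟩
    rintro ⟨x, y⟩ ⟨⟨hxy, hb⟩, hne⟩
    simp only [Set.mem_ofPred_eq] at hxy
    rw [mem_ball_zero_iff, Prod.norm_def] at hb
    have hy1 : |y| < 1 := lt_of_le_of_lt (le_max_right _ _) hb
    have hx : |x| ≤ |y| ^ s⁻¹ := by
      have := Real.rpow_le_rpow (by positivity) hxy (inv_pos.2 h0).le
      rwa [Real.rpow_rpow_inv (abs_nonneg x) h0.ne'] at this
    have hy : 0 < |y| := by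
      rcases (abs_nonneg y).eq_or_lt with h | h
      · exfalso
        apply hne
        rw [← h, Real.zero_rpow (inv_pos.2 h0).ne'] at hx
        have hx0 : x = 0 := abs_nonpos_iff.1 hx
        have hy0 : y = 0 := abs_eq_zero.1 h.symm
        simp [hx0, hy0]
      · exact h
    simp only [Vset, Set.mem_ofPred_eq, one_mul, zero_mul, add_zero]
    calc |x| ≤ |y| ^ s⁻¹ := hx
      _ < |y| ^ α := Real.rpow_lt_rpow_of_exponent_gt hy hy1 ha2
      _ ≤ _ := Real.rpow_le_rpow hy.le (le_max_right _ _) (by linarith)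

lemma thin_S (s : ℝ) (h1 : 1 < s) :
    ThinCusp {p : ℝ × ℝ | |p.2| ≤ |p.1| ^ s} := by
  have h0 : 0 < s := by linarith
  refine ⟨thin_of_open (W := {p : ℝ × ℝ | |p.2| < |p.1| ^ s}) ?_ ?_ ?_, ?_⟩
  · refine isOpen_lt (by fun_prop) ?_
    exact (continuous_fst.abs).rpow_const (fun _ => Or.inr h0.le)
  · intro p hp
    simp only [Set.mem_ofPred_eq] at hp ⊢
    exact hp.le
  · intro δ hδ
    refine ⟨(δ / 2, 0), ?_, ?_⟩
    · rw [mem_ball_zero_iff, Prod.norm_def]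
      simp only [norm_zero, Real.norm_eq_abs, abs_of_pos (half_pos hδ)]
      exact max_lt (half_lt_self hδ) hδ
    · simp only [Set.mem_ofPred_eq, abs_zero]
      exact Real.rpow_pos_of_pos (abs_pos.2 (half_pos hδ).ne') _
  · obtain ⟨α, ha1, ha2⟩ := exists_between h1
    refine ⟨0, 1, α, 1, ha1, one_pos, ?_⟩
    rintro ⟨x, y⟩ ⟨⟨hxy, hb⟩, hne⟩
    simp only [Set.mem_ofPred_eq] at hxy
    rw [mem_ball_zero_iff, Prod.norm_def] at hb
    have hx1 : |x| < 1 := lt_of_le_of_lt (le_max_left _ _) hb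
    have hx : 0 < |x| := by
      rcases (abs_nonneg x).eq_or_lt with h | h
      · exfalso
        apply hne
        rw [← h, Real.zero_rpow h0.ne'] at hxy
        have hy0 : y = 0 := abs_nonpos_iff.1 hxy
        have hx0 : x = 0 := abs_eq_zero.1 h.symm
        simp [hx0, hy0]
      · exact h
    simp only [Vset, Set.mem_ofPred_eq, one_mul, zero_mul, zero_add]
    calc |y| ≤ |x| ^ s := hxy
      _ < |x| ^ α := Real.rpow_lt_rpow_of_exponent_gt hx hx1 ha2
      _ ≤ _ := Real.rpow_le_rpow hx.le (le_max_left _ _) (by linarith)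

lemma thick_of_two {U A B : Set (ℝ × ℝ)} (hA : ThinCusp A) (hB : ThinCusp B)
    (h : ∀ p, p ∉ U ↔ p ∈ A ∨ p ∈ B) : ThickCusp U := by
  refine ⟨2, ![A, B], ?_, ?_⟩
  · intro i
    fin_cases i
    · exact hA
    · exact hB
  · ext p
    simp [h p, Fin.exists_fin_two]

/-- (a) For `0 < h < 1` and `0 < t < 1`, the set
`{(x₁,x₂) : |x₂| < |x₁|^h ∧ |x₂| < |x₁|^t}` is a thick cusp.
(b) For `h > 1` and `0 < t < 1`, the set `{(x₁,x₂) : |x₁|^h < |x₂| ∧ |x₂| < |x₁|^t}`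
is a thick cusp. -/
theorem statement10 :
    (∀ h t : ℝ, 0 < h → h < 1 → 0 < t → t < 1 →
      ThickCusp {p : ℝ × ℝ | |p.2| < |p.1| ^ h ∧ |p.2| < |p.1| ^ t}) ∧
    (∀ h t : ℝ, 1 < h → 0 < t → t < 1 →
      ThickCusp {p : ℝ × ℝ | |p.1| ^ h < |p.2| ∧ |p.2| < |p.1| ^ t}) := by
  refine ⟨fun h t h0 h1 t0 t1 => ?_, fun h t h1 t0 t1 => ?_⟩
  · refine thick_of_two (thin_T h h0 h1) (thin_T t t0 t1) fun p => ?_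
    simp only [Set.mem_ofPred_eq, not_and_or, not_lt]
  · refine thick_of_two (thin_S h h1) (thin_T t t0 t1) fun p => ?_
    simp only [Set.mem_ofPred_eq, not_and_or, not_lt]

end
end

section
/- Let a₁, a₂, b₁, b₂ ∈ ℝ with a₁b₂ − a₂b₁ ≠ 0, and let α > 1 and β > 1. Then there exists δ > 0 such that V(a₁,a₂,α) ∩ V(b₁,b₂,β) ∩ B_δ = ∅. -/
open MeasureTheory

noncomputable section

/-- If `a₁b₂ - a₂b₁ ≠ 0` and `α, β > 1`, then near the origin the cusps
`V(a₁,a₂,α)` and `V(b₁,b₂,β)` are disjoint. -/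
theorem statement11 (a₁ a₂ b₁ b₂ α β : ℝ) (hdet : a₁ * b₂ - a₂ * b₁ ≠ 0)
    (hα : 1 < α) (hβ : 1 < β) :
    ∃ δ : ℝ, 0 < δ ∧ Vset a₁ a₂ α ∩ Vset b₁ b₂ β ∩ Metric.ball (0 : ℝ × ℝ) δ = ∅ := by
  have hcont : ContinuousAt (fun t : ℝ => (|a₁| + |a₂| + |b₁| + |b₂|) *
      (t ^ (α - 1) + t ^ (β - 1))) 0 := by
    apply ContinuousAt.mul continuousAt_const
    exact (Real.continuousAt_rpow_const _ _ (Or.inr (by linarith))).add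
      (Real.continuousAt_rpow_const _ _ (Or.inr (by linarith)))
  have hD : 0 < |a₁ * b₂ - a₂ * b₁| := abs_pos.mpr hdet
  obtain ⟨δ, hδ, h⟩ := Metric.continuousAt_iff.mp hcont _ hD
  refine ⟨δ, hδ, ?_⟩
  rw [Set.eq_empty_iff_forall_notMem]
  rintro ⟨x, y⟩ ⟨⟨hA, hB⟩, hb⟩
  simp only [Vset, Set.mem_setOf_eq] at hA hB
  rw [mem_ball_zero_iff, Prod.norm_def] at hb
  simp only [Real.norm_eq_abs] at hb
  obtain ⟨M, hM⟩ : ∃ M, M = max |x| |y| := ⟨_, rfl⟩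
  rw [← hM] at hA hB hb
  have hM0 : 0 ≤ M := by rw [hM]; positivity
  have hMpos : 0 < M := by
    rcases hM0.lt_or_eq with h0 | h0
    · exact h0
    · rw [← h0, Real.zero_rpow (by linarith)] at hA
      exact absurd hA (not_lt.mpr (abs_nonneg _))
  have h1 := h (x := M) (by rwa [Real.dist_eq, sub_zero, abs_of_pos hMpos])
  rw [Real.dist_eq, Real.zero_rpow (by linarith), Real.zero_rpow (by linarith)] at h1
  have h2 := lt_of_le_of_lt (le_abs_self _) h1
  have eα : M ^ α = M ^ (α - 1) * M := by
    rw [← Real.rpow_add_one hMpos.ne']; congr 1; ring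
  have eβ : M ^ β = M ^ (β - 1) * M := by
    rw [← Real.rpow_add_one hMpos.ne']; congr 1; ring
  have pα : 0 ≤ M ^ α := by positivity
  have pβ : 0 ≤ M ^ β := by positivity
  have key : |a₁ * b₂ - a₂ * b₁| * M ≤ (|a₁| + |a₂| + |b₁| + |b₂|) * (M ^ α + M ^ β) := by
    have aux : ∀ c d : ℝ, |c * (a₁ * x + a₂ * y) + d * (b₁ * x + b₂ * y)| ≤
        |c| * M ^ α + |d| * M ^ β := by
      intro c d
      refine (abs_add_le _ _).trans ?_
      rw [abs_mul, abs_mul]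
      gcongr
    have hx : |a₁ * b₂ - a₂ * b₁| * |x| ≤ |b₂| * M ^ α + |a₂| * M ^ β := by
      have := aux b₂ (-a₂)
      rw [abs_neg] at this
      rw [← abs_mul]
      rwa [show b₂ * (a₁ * x + a₂ * y) + -a₂ * (b₁ * x + b₂ * y) =
        (a₁ * b₂ - a₂ * b₁) * x by ring] at this
    have hy : |a₁ * b₂ - a₂ * b₁| * |y| ≤ |b₁| * M ^ α + |a₁| * M ^ β := by
      have := aux (-b₁) a₁
      rw [abs_neg] at this
      rw [← abs_mul]
      rwa [show -b₁ * (a₁ * x + a₂ * y) + a₁ * (b₁ * x + b₂ * y) =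
        (a₁ * b₂ - a₂ * b₁) * y by ring] at this
    have q : ∀ c : ℝ, 0 ≤ |c| * M ^ α ∧ 0 ≤ |c| * M ^ β := fun c =>
      ⟨by positivity, by positivity⟩
    have := q a₁
    have := q a₂
    have := q b₁
    have := q b₂
    rcases max_choice |x| |y| with e | e <;> rw [hM.trans e] at * <;> grind
  rw [eα, eβ] at key
  have h3 := mul_lt_mul_of_pos_right h2 hMpos
  nlinarith

end
end

section
/- Let α > 1, a₁, a₂ ∈ ℝ, δ₀ > 0 and U ⊆ ℝ² with (U ∩ B_{δ₀}) ∖ {(0,0)} ⊆ V(a₁,a₂,α). Let W ⊆ ℝ² be a set whose complement in ℝ² equals U₁ ∪ … ∪ U_m, where for each i there exist b_{i1}, b_{i2} ∈ ℝ, β_i > 1 and δ_i > 0 with (U_i ∩ B_{δ_i}) ∖ {(0,0)} ⊆ V(b_{i1},b_{i2},β_i) and a₁·b_{i2} − a₂·b_{i1} ≠ 0. Then there exists δ > 0 such that (U ∩ B_δ) ∖ {(0,0)} ⊆ W. -/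
open MeasureTheory

noncomputable section

lemma exists_radius (D C α β : ℝ) (hD : D ≠ 0) (hα : 1 < α) (hβ : 1 < β) :
    ∀ᶠ M in nhdsWithin (0 : ℝ) (Set.Ioi 0), C * M ^ (α - 1) + C * M ^ (β - 1) < |D| := by
  have h : Filter.Tendsto (fun M : ℝ => C * M ^ (α - 1) + C * M ^ (β - 1)) (nhds 0)
      (nhds (C * (0 : ℝ) ^ (α - 1) + C * (0 : ℝ) ^ (β - 1))) := by
    have h1 := (Real.continuousAt_rpow_const (0 : ℝ) (α - 1) (Or.inr (by linarith))).tendsto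
    have h2 := (Real.continuousAt_rpow_const (0 : ℝ) (β - 1) (Or.inr (by linarith))).tendsto
    exact (h1.const_mul C).add (h2.const_mul C)
  rw [Real.zero_rpow (by linarith), Real.zero_rpow (by linarith)] at h
  have h' := h.eventually_lt_const (u := |D|) (by simpa using hD)
  exact h'.filter_mono nhdsWithin_le_nhds

lemma cusp_bound (a₁ a₂ b₁ b₂ x y α β : ℝ) (hM : 0 < max |x| |y|)
    (h1 : |a₁ * x + a₂ * y| < (max |x| |y|) ^ α)
    (h2 : |b₁ * x + b₂ * y| < (max |x| |y|) ^ β) :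
    |a₁ * b₂ - a₂ * b₁| ≤ (|a₁| + |a₂| + |b₁| + |b₂|) * (max |x| |y|) ^ (α - 1)
      + (|a₁| + |a₂| + |b₁| + |b₂|) * (max |x| |y|) ^ (β - 1) := by
  set M := max |x| |y| with hMdef
  set C := |a₁| + |a₂| + |b₁| + |b₂| with hC
  have e1 : M ^ α = M ^ (α - 1) * M := by
    rw [← Real.rpow_add_one hM.ne', sub_add_cancel]
  have e2 : M ^ β = M ^ (β - 1) * M := by
    rw [← Real.rpow_add_one hM.ne', sub_add_cancel]
  have n1 := abs_nonneg a₁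
  have n2 := abs_nonneg a₂
  have n3 := abs_nonneg b₁
  have n4 := abs_nonneg b₂
  have key : ∀ u v z : ℝ, |u| ≤ C → |v| ≤ C →
      (a₁ * b₂ - a₂ * b₁) * z = u * (a₁ * x + a₂ * y) - v * (b₁ * x + b₂ * y) →
      |a₁ * b₂ - a₂ * b₁| * |z| ≤ C * M ^ α + C * M ^ β := by
    intro u v z hu hv hz
    rw [← abs_mul, hz]
    refine (abs_sub _ _).trans ?_
    rw [abs_mul, abs_mul]
    gcongr
  have hx := key b₂ a₂ x (by linarith) (by linarith) (by ring)
  have hy := key (-b₁) (-a₁) y (by rw [abs_neg]; linarith) (by rw [abs_neg]; linarith) (by ring)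
  have hm : |a₁ * b₂ - a₂ * b₁| * M ≤ C * M ^ α + C * M ^ β := by
    rcases max_choice |x| |y| with h | h
    · rw [← hMdef] at h; rwa [← h] at hx
    · rw [← hMdef] at h; rwa [← h] at hy
  rw [e1, e2] at hm
  refine le_of_mul_le_mul_right ?_ hM
  linarith

/-- A set `U` lying (near `0`, apart from the origin) in a cusp
`V(a₁,a₂,α)` transversal to finitely many thin-cusp regions whose union is the complement
of `W` is, near the origin, contained in `W`. -/
theorem statement12 (a₁ a₂ α δ₀ : ℝ) (U W : Set (ℝ × ℝ))
    (m : ℕ) (Us : Fin m → Set (ℝ × ℝ)) (b₁ b₂ β δs : Fin m → ℝ)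
    (hα : 1 < α) (hδ₀ : 0 < δ₀)
    (hU : (U ∩ Metric.ball (0 : ℝ × ℝ) δ₀) \ {(0, 0)} ⊆ Vset a₁ a₂ α)
    (hW : Wᶜ = ⋃ i, Us i)
    (hβ : ∀ i, 1 < β i) (hδs : ∀ i, 0 < δs i)
    (hUs : ∀ i, (Us i ∩ Metric.ball (0 : ℝ × ℝ) (δs i)) \ {(0, 0)} ⊆
      Vset (b₁ i) (b₂ i) (β i))
    (htrans : ∀ i, a₁ * b₂ i - a₂ * b₁ i ≠ 0) :
    ∃ δ : ℝ, 0 < δ ∧ (U ∩ Metric.ball (0 : ℝ × ℝ) δ) \ {(0, 0)} ⊆ W := by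
  have hev : ∀ᶠ M in nhdsWithin (0 : ℝ) (Set.Ioi 0), ∀ i,
      ((|a₁| + |a₂| + |b₁ i| + |b₂ i|) * M ^ (α - 1)
        + (|a₁| + |a₂| + |b₁ i| + |b₂ i|) * M ^ (β i - 1) < |a₁ * b₂ i - a₂ * b₁ i|)
      ∧ M < δs i := by
    rw [Filter.eventually_all]
    intro i
    exact (exists_radius _ _ _ _ (htrans i) hα (hβ i)).and
      (nhdsWithin_le_nhds (gt_mem_nhds (hδs i)))
  rw [Filter.Eventually, mem_nhdsGT_iff_exists_Ioo_subset] at hev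
  obtain ⟨r, hr, hsub⟩ := hev
  refine ⟨min r δ₀, lt_min hr hδ₀, ?_⟩
  rintro ⟨x, y⟩ ⟨⟨hpU, hpb⟩, hp0⟩
  by_contra hpW
  have hc : (x, y) ∈ Wᶜ := hpW
  rw [hW, Set.mem_iUnion] at hc
  obtain ⟨i, hi⟩ := hc
  have hn : max |x| |y| < min r δ₀ := by
    simpa [Prod.norm_def] using mem_ball_zero_iff.mp hpb
  have hpos : 0 < max |x| |y| := by
    by_contra hle
    have h0 := not_lt.mp hle
    have hx : x = 0 := abs_nonpos_iff.mp ((le_max_left _ _).trans h0)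
    have hy : y = 0 := abs_nonpos_iff.mp ((le_max_right _ _).trans h0)
    exact hp0 (by simp [hx, hy])
  have hM := hsub ⟨hpos, hn.trans_le (min_le_left _ _)⟩ i
  have hv1 := hU ⟨⟨hpU, mem_ball_zero_iff.mpr (by
    simpa [Prod.norm_def] using hn.trans_le (min_le_right _ _))⟩, hp0⟩
  have hv2 := hUs i ⟨⟨hi, mem_ball_zero_iff.mpr (by
    simpa [Prod.norm_def] using hM.2)⟩, hp0⟩
  exact absurd hM.1 (not_lt.mpr (cusp_bound a₁ a₂ (b₁ i) (b₂ i) x y α (β i) hpos hv1 hv2))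

end
end

section
/- Let α, β be real numbers with 0 < α < 1 + β, let A₁, A₂, A₃, A₄ ∈ ℝ with A₁ ≠ 0 and A₃ ≠ 0, let m > 0 and 0 < c < m, and let s satisfy 0 < s < (1+β)/α − 1. Then there exists ε > 0 such that for all (x₁,x₂) ∈ ℝ² with 0 < x₂ < ε and |x₁ − m·x₂| < c·x₂, the point (y₁,y₂) := (A₁·x₁^α + A₂·x₂·x₁^β, A₃·x₁^α + A₄·x₂·x₁^β) satisfies |y₁ − (A₁/A₃)·y₂| < |y₁|^{(1+β)/α − s}. -/
theorem small_rpow_aux (C r b : ℝ) (hr : 0 < r) (hb : 0 < b) :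
    ∃ δ : ℝ, 0 < δ ∧ ∀ x : ℝ, 0 < x → x < δ → C * x ^ r < b := by
  have h : Filter.Tendsto (fun x : ℝ => C * x ^ r) (nhds 0) (nhds (C * (0:ℝ) ^ r)) :=
    ((Real.continuousAt_rpow_const 0 r (Or.inr hr.le)).tendsto).const_mul C
  rw [Real.zero_rpow hr.ne', mul_zero] at h
  obtain ⟨δ, hδ, H⟩ := Metric.eventually_nhds_iff.1 (h.eventually (gt_mem_nhds hb))
  refine ⟨δ, hδ, fun x hx hxd => H ?_⟩
  rw [Real.dist_eq, sub_zero, abs_of_pos hx]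
  exact hxd

/-- Let `0 < α < 1 + β`, `A₁ ≠ 0`, `A₃ ≠ 0`, `0 < c < m` and
`0 < s < (1+β)/α - 1`. Then, for points in the cusp `{0 < x₂, |x₁ - m·x₂| < c·x₂}`
sufficiently close to the origin, the image
`(y₁,y₂) = (A₁x₁^α + A₂x₂x₁^β, A₃x₁^α + A₄x₂x₁^β)` satisfies
`|y₁ - (A₁/A₃)y₂| < |y₁|^{(1+β)/α - s}`. -/
theorem statement13 (α β A₁ A₂ A₃ A₄ m c s : ℝ)
    (hα : 0 < α) (hαβ : α < 1 + β) (hA₁ : A₁ ≠ 0) (hA₃ : A₃ ≠ 0)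
    (hc : 0 < c) (hcm : c < m)
    (hs : 0 < s) (hs' : s < (1 + β) / α - 1) :
    ∃ ε : ℝ, 0 < ε ∧ ∀ x₁ x₂ : ℝ, 0 < x₂ → x₂ < ε → |x₁ - m * x₂| < c * x₂ →
      |(A₁ * x₁ ^ α + A₂ * x₂ * x₁ ^ β) -
          (A₁ / A₃) * (A₃ * x₁ ^ α + A₄ * x₂ * x₁ ^ β)| <
        |A₁ * x₁ ^ α + A₂ * x₂ * x₁ ^ β| ^ ((1 + β) / α - s) := by
  have hmc : 0 < m - c := by linarith
  have hmc' : 0 < m + c := by linarith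
  have hA : 0 < |A₁| := abs_pos.2 hA₁
  have hp : 0 < (1 + β) / α - s := by linarith
  obtain ⟨δ₁, hδ₁, H₁⟩ := small_rpow_aux (|A₂| / (m - c)) (1 + β - α) (|A₁| / 2)
    (by linarith) (by linarith)
  obtain ⟨δ₂, hδ₂, H₂⟩ := small_rpow_aux (|A₂ - A₁ / A₃ * A₄| / (m - c)) (α * s)
    ((|A₁| / 2) ^ ((1 + β) / α - s)) (by positivity) (by positivity)
  refine ⟨min δ₁ δ₂ / (m + c), by positivity, fun x₁ x₂ h0 hε hx => ?_⟩
  rw [lt_div_iff₀ hmc'] at hε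
  obtain ⟨hl, hu⟩ := abs_lt.1 hx
  have hlow : (m - c) * x₂ < x₁ := by linarith
  have hx₁ : 0 < x₁ := lt_trans (by positivity) hlow
  have hxd : x₁ < min δ₁ δ₂ := by nlinarith
  have h1 := H₁ x₁ hx₁ (hxd.trans_le (min_le_left _ _))
  have h2 := H₂ x₁ hx₁ (hxd.trans_le (min_le_right _ _))
  have hx₂ : x₂ ≤ x₁ / (m - c) := by
    rw [le_div_iff₀ hmc]; linarith
  have hb : x₂ * x₁ ^ β ≤ x₁ ^ (1 + β) / (m - c) := by
    rw [Real.rpow_add hx₁, Real.rpow_one, mul_div_right_comm]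
    gcongr
  have hpa : 0 < x₁ ^ α := by positivity
  have hpb : 0 < x₂ * x₁ ^ β := by positivity
  have hlhs : |(A₁ * x₁ ^ α + A₂ * x₂ * x₁ ^ β) -
      (A₁ / A₃) * (A₃ * x₁ ^ α + A₄ * x₂ * x₁ ^ β)|
      = |A₂ - A₁ / A₃ * A₄| * (x₂ * x₁ ^ β) := by
    rw [← abs_of_pos hpb, ← abs_mul]
    congr 1
    field_simp
    ring
  have hy : |A₁| / 2 * x₁ ^ α ≤ |A₁ * x₁ ^ α + A₂ * x₂ * x₁ ^ β| := by
    have e1 : |A₁ * x₁ ^ α| = |A₁| * x₁ ^ α := by rw [abs_mul, abs_of_pos hpa]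
    have e2 : |A₂ * x₂ * x₁ ^ β| = |A₂| * (x₂ * x₁ ^ β) := by
      rw [mul_assoc, abs_mul, abs_of_pos hpb]
    have e3 : |A₂| * (x₂ * x₁ ^ β) ≤ |A₁| / 2 * x₁ ^ α := by
      calc |A₂| * (x₂ * x₁ ^ β) ≤ |A₂| * (x₁ ^ (1 + β) / (m - c)) := by gcongr
        _ = (|A₂| / (m - c) * x₁ ^ (1 + β - α)) * x₁ ^ α := by
          rw [mul_assoc, ← Real.rpow_add hx₁, sub_add_cancel]; ring
        _ ≤ _ := by gcongr
    have e4 := abs_sub_abs_le_abs_sub (A₁ * x₁ ^ α) (-(A₂ * x₂ * x₁ ^ β))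
    rw [abs_neg, sub_neg_eq_add] at e4
    linarith
  rw [hlhs]
  calc |A₂ - A₁ / A₃ * A₄| * (x₂ * x₁ ^ β)
      ≤ |A₂ - A₁ / A₃ * A₄| * (x₁ ^ (1 + β) / (m - c)) := by gcongr
    _ = (|A₂ - A₁ / A₃ * A₄| / (m - c) * x₁ ^ (α * s)) * x₁ ^ (α * ((1 + β) / α - s)) := by
      rw [mul_assoc, ← Real.rpow_add hx₁]
      have : α * s + α * ((1 + β) / α - s) = 1 + β := by field_simp; ring
      rw [this]; ring
    _ < (|A₁| / 2) ^ ((1 + β) / α - s) * x₁ ^ (α * ((1 + β) / α - s)) := by gcongr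
    _ = (|A₁| / 2 * x₁ ^ α) ^ ((1 + β) / α - s) := by
      rw [Real.mul_rpow (by positivity) hpa.le, Real.rpow_mul hx₁.le]
    _ ≤ _ := Real.rpow_le_rpow (by positivity) hy hp.le
end

section
/- Let α, β be real numbers with β > −1 and α > 1 + β, let A₁, A₂, A₃, A₄ ∈ ℝ with A₄ ≠ 0, let m > 0 and 0 < c < m, and let s satisfy 0 < s < α/(1+β) − 1. Then there exists ε > 0 such that for all (x₁,x₂) ∈ ℝ² with 0 < x₂ < ε and |x₁ − m·x₂| < c·x₂, the point (y₁,y₂) := (A₁·x₁^α + A₂·x₂·x₁^β, A₃·x₁^α + A₄·x₂·x₁^β) satisfies |y₁ − (A₂/A₄)·y₂| < |y₂|^{α/(1+β) − s}. -/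
/-- Let `β > -1`, `α > 1 + β`, `A₄ ≠ 0`, `0 < c < m` and
`0 < s < α/(1+β) - 1`. Then, for points in the cusp `{0 < x₂, |x₁ - m·x₂| < c·x₂}`
sufficiently close to the origin, the image
`(y₁,y₂) = (A₁x₁^α + A₂x₂x₁^β, A₃x₁^α + A₄x₂x₁^β)` satisfies
`|y₁ - (A₂/A₄)y₂| < |y₂|^{α/(1+β) - s}`. -/
theorem statement14 (α β A₁ A₂ A₃ A₄ m c s : ℝ)
    (hβ : -1 < β) (hαβ : 1 + β < α) (hA₄ : A₄ ≠ 0)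
    (hc : 0 < c) (hcm : c < m)
    (hs : 0 < s) (hs' : s < α / (1 + β) - 1) :
    ∃ ε : ℝ, 0 < ε ∧ ∀ x₁ x₂ : ℝ, 0 < x₂ → x₂ < ε → |x₁ - m * x₂| < c * x₂ →
      |(A₁ * x₁ ^ α + A₂ * x₂ * x₁ ^ β) -
          (A₂ / A₄) * (A₃ * x₁ ^ α + A₄ * x₂ * x₁ ^ β)| <
        |A₃ * x₁ ^ α + A₄ * x₂ * x₁ ^ β| ^ (α / (1 + β) - s) := by
  have hb : 0 < 1 + β := by linarith
  have hmc : 0 < m + c := by linarith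
  set p := α / (1 + β) - s with hp
  have hp0 : 0 < p := by linarith
  have hpe : (1 + β) * p = α - s * (1 + β) := by
    rw [hp]; field_simp
  have hA : 0 < |A₄| := abs_pos.mpr hA₄
  obtain ⟨a, ha⟩ : ∃ a, a = |A₄| / (m + c) := ⟨_, rfl⟩
  have ha0 : 0 < a := by rw [ha]; positivity
  have hq0 : 0 < (a / 2) ^ p := by positivity
  obtain ⟨K, hK⟩ : ∃ K, K = |A₁ - A₂ / A₄ * A₃| := ⟨_, rfl⟩
  have key : ∀ C g d : ℝ, 0 < g → 0 < d →
      ∃ η > 0, ∀ x : ℝ, 0 < x → x < η → C * x ^ g < d := by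
    intro C g d hg hd
    have hcont : ContinuousAt (fun x : ℝ => C * x ^ g) 0 :=
      (Real.continuousAt_rpow_const 0 g (Or.inr hg.le)).const_mul C
    have hev : ∀ᶠ x : ℝ in nhds 0, C * x ^ g < d := by
      apply hcont.eventually_lt_const
      simpa [Real.zero_rpow hg.ne'] using hd
    obtain ⟨η, hη, h⟩ := Metric.eventually_nhds_iff.mp hev
    refine ⟨η, hη, fun x hx hxη => h ?_⟩
    rw [Real.dist_eq, sub_zero, abs_of_pos hx]
    exact hxη
  obtain ⟨η₁, hη₁, h₁⟩ := key |A₃| (α - (1 + β)) (a / 2) (by linarith) (by linarith)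
  obtain ⟨η₂, hη₂, h₂⟩ := key K (s * (1 + β)) ((a / 2) ^ p) (by positivity) hq0
  refine ⟨min η₁ η₂ / (m + c), div_pos (lt_min hη₁ hη₂) hmc, ?_⟩
  intro x y hy hyε hxy
  rw [lt_div_iff₀ hmc] at hyε
  obtain ⟨hl, hu⟩ := abs_lt.mp hxy
  have hx : 0 < x := by nlinarith
  have hxu : x < y * (m + c) := by linarith
  have hxη : x < min η₁ η₂ := hxu.trans hyε
  have e₁ := h₁ x hx (hxη.trans_le (min_le_left _ _))
  have e₂ := h₂ x hx (hxη.trans_le (min_le_right _ _))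
  have hL : (A₁ * x ^ α + A₂ * y * x ^ β) - (A₂ / A₄) * (A₃ * x ^ α + A₄ * y * x ^ β)
      = (A₁ - A₂ / A₄ * A₃) * x ^ α := by
    field_simp; ring
  have hxα : 0 < x ^ α := Real.rpow_pos_of_pos hx _
  have hxβ : 0 < x ^ β := Real.rpow_pos_of_pos hx _
  have hxb : 0 < x ^ (1 + β) := Real.rpow_pos_of_pos hx _
  rw [hL, abs_mul, abs_of_pos hxα, ← hK]
  have hlow : a / 2 * x ^ (1 + β) ≤ |A₃ * x ^ α + A₄ * y * x ^ β| := by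
    have t1 : |A₄ * y * x ^ β| - |A₃ * x ^ α| ≤ |A₃ * x ^ α + A₄ * y * x ^ β| := by
      have := abs_sub_abs_le_abs_sub (A₄ * y * x ^ β) (-(A₃ * x ^ α))
      rw [abs_neg, sub_neg_eq_add, add_comm (A₄ * y * x ^ β)] at this
      exact this
    rw [abs_mul, abs_mul, abs_mul, abs_of_pos hy, abs_of_pos hxα, abs_of_pos hxβ] at t1
    have t2 : a * x ≤ |A₄| * y := by
      rw [ha, div_mul_eq_mul_div, div_le_iff₀ hmc]
      nlinarith
    have t3 : x ^ (1 + β) = x * x ^ β := by rw [Real.rpow_add hx, Real.rpow_one]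
    have t4 : x ^ α = x ^ (α - (1 + β)) * x ^ (1 + β) := by
      rw [← Real.rpow_add hx]; congr 1; ring
    have t5 : |A₃| * x ^ α ≤ a / 2 * x ^ (1 + β) := by
      rw [t4, ← mul_assoc]
      exact mul_le_mul_of_nonneg_right e₁.le hxb.le
    have t6 : a * x ^ (1 + β) ≤ |A₄| * y * x ^ β := by
      rw [t3, ← mul_assoc]
      exact mul_le_mul_of_nonneg_right t2 hxβ.le
    linarith
  refine lt_of_lt_of_le ?_ (Real.rpow_le_rpow (by positivity) hlow hp0.le)
  rw [Real.mul_rpow (by positivity) hxb.le, ← Real.rpow_mul hx.le, hpe]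
  have t7 : x ^ α = x ^ (s * (1 + β)) * x ^ (α - s * (1 + β)) := by
    rw [← Real.rpow_add hx]; congr 1; ring
  rw [t7, ← mul_assoc]
  exact mul_lt_mul_of_pos_right e₂ (Real.rpow_pos_of_pos hx _)
end

section
/- Let α, β be real numbers with 0 < α < β, let A₁, A₂, A₃, A₄ ∈ ℝ with A₃ ≠ 0, let M > 0, and let s satisfy 0 < s < β − α. Then there exists ε > 0 such that for all x₁ with 0 < x₁ < ε and all x₂ with |x₂| ≤ M, the point (y₁,y₂) := (A₁·x₁^α + A₂·x₂·x₁^β, A₃·x₁^α + A₄·x₂·x₁^β) satisfies |y₁ − (A₁/A₃)·y₂| < |y₂|^{(β−s)/α}, and the exponent (β−s)/α is strictly greater than 1. -/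
/-- Let `0 < α < β`, `A₃ ≠ 0`, `M > 0` and `0 < s < β - α`. Then for all
`x₁ > 0` small enough and all `|x₂| ≤ M`, the point
`(y₁,y₂) = (A₁x₁^α + A₂x₂x₁^β, A₃x₁^α + A₄x₂x₁^β)` satisfies
`|y₁ - (A₁/A₃)y₂| < |y₂|^{(β-s)/α}`, the exponent `(β-s)/α` being greater than `1`. -/
theorem statement15 (α β A₁ A₂ A₃ A₄ M s : ℝ)
    (hα : 0 < α) (hαβ : α < β) (hA₃ : A₃ ≠ 0) (hM : 0 < M)
    (hs : 0 < s) (hs' : s < β - α) :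
    (∃ ε : ℝ, 0 < ε ∧ ∀ x₁ x₂ : ℝ, 0 < x₁ → x₁ < ε → |x₂| ≤ M →
      |(A₁ * x₁ ^ α + A₂ * x₂ * x₁ ^ β) -
          (A₁ / A₃) * (A₃ * x₁ ^ α + A₄ * x₂ * x₁ ^ β)| <
        |A₃ * x₁ ^ α + A₄ * x₂ * x₁ ^ β| ^ ((β - s) / α)) ∧
    1 < (β - s) / α := by
  have hp : 1 < (β - s) / α := by
    rw [lt_div_iff₀ hα]; linarith
  refine ⟨?_, hp⟩
  have hA : 0 < |A₃| := abs_pos.mpr hA₃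
  have small : ∀ (C r c : ℝ), 0 < r → 0 < c → ∀ᶠ x : ℝ in nhds 0, C * x ^ r < c := by
    intro C r c hr hc
    have h1 : Filter.Tendsto (fun x : ℝ => C * x ^ r) (nhds 0) (nhds (C * (0 : ℝ) ^ r)) :=
      ((Real.continuousAt_rpow_const 0 r (Or.inr hr.le)).tendsto).const_mul C
    rw [Real.zero_rpow hr.ne', mul_zero] at h1
    exact h1.eventually (gt_mem_nhds hc)
  have hc : 0 < (|A₃| / 2) ^ ((β - s) / α) := Real.rpow_pos_of_pos (by linarith) _
  obtain ⟨ε, hε, H⟩ := Metric.eventually_nhds_iff.mp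
    ((small (|A₂ - A₁ / A₃ * A₄| * M) s _ hs hc).and
      (small (|A₄| * M) (β - α) (|A₃| / 2) (by linarith) (by linarith)))
  refine ⟨ε, hε, ?_⟩
  intro x z hx hxε hz
  obtain ⟨h1, h2⟩ := H (y := x) (by rw [Real.dist_eq, sub_zero, abs_of_pos hx]; exact hxε)
  have hxa : 0 < x ^ α := Real.rpow_pos_of_pos hx _
  have hxb : 0 < x ^ β := Real.rpow_pos_of_pos hx _
  have hxbs : 0 < x ^ (β - s) := Real.rpow_pos_of_pos hx _
  have e1 : x ^ β = x ^ s * x ^ (β - s) := by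
    rw [← Real.rpow_add hx]; congr 1; ring
  have e2 : x ^ β = x ^ (β - α) * x ^ α := by
    rw [← Real.rpow_add hx]; congr 1; ring
  have e3 : (A₁ * x ^ α + A₂ * z * x ^ β) - (A₁ / A₃) * (A₃ * x ^ α + A₄ * z * x ^ β)
      = (A₂ - A₁ / A₃ * A₄) * z * x ^ β := by
    field_simp
    ring
  have hlow : |A₃| / 2 * x ^ α ≤ |A₃ * x ^ α + A₄ * z * x ^ β| := by
    have t1 : |A₃ * x ^ α| - |A₄ * z * x ^ β| ≤ |A₃ * x ^ α + A₄ * z * x ^ β| := by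
      have := abs_sub_abs_le_abs_sub (A₃ * x ^ α) (-(A₄ * z * x ^ β))
      rwa [abs_neg, sub_neg_eq_add] at this
    have t2 : |A₄ * z * x ^ β| ≤ |A₃| / 2 * x ^ α := by
      calc |A₄ * z * x ^ β| = |A₄| * |z| * x ^ β := by
            rw [abs_mul, abs_mul, abs_of_pos hxb]
        _ ≤ |A₄| * M * x ^ β := by gcongr
        _ = (|A₄| * M * x ^ (β - α)) * x ^ α := by rw [e2]; ring
        _ ≤ |A₃| / 2 * x ^ α := by gcongr
    have t3 : |A₃ * x ^ α| = |A₃| * x ^ α := by rw [abs_mul, abs_of_pos hxa]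
    linarith
  rw [e3]
  calc |(A₂ - A₁ / A₃ * A₄) * z * x ^ β| = |A₂ - A₁ / A₃ * A₄| * |z| * x ^ β := by
        rw [abs_mul, abs_mul, abs_of_pos hxb]
    _ ≤ |A₂ - A₁ / A₃ * A₄| * M * x ^ β := by gcongr
    _ = (|A₂ - A₁ / A₃ * A₄| * M * x ^ s) * x ^ (β - s) := by rw [e1]; ring
    _ < (|A₃| / 2) ^ ((β - s) / α) * x ^ (β - s) := mul_lt_mul_of_pos_right h1 hxbs
    _ = (|A₃| / 2 * x ^ α) ^ ((β - s) / α) := by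
        rw [Real.mul_rpow (by linarith) hxa.le, ← Real.rpow_mul hx.le, mul_div_cancel₀ _ hα.ne']
    _ ≤ _ := Real.rpow_le_rpow (by positivity) hlow (by linarith)
end
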